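/- arXiv:1911.07647 — 2 statements merged into one kernel-verified Lean document; each statement's English description precedes it below -/
import Mathlib

section
/- Let m ≥ 2, let f be K-bandlimited on the circle, N ≥ 2K+1, and y_n := f(2πn/N) for 0 ≤ n ≤ N−1. Let q_0,…,q_{N−1} ∈ ℝ and let u : ℤ → ℝ satisfy u_{−1} = u_{−2} = … = u_{−m} = 0 and (Δ^m u)_n = y_n − q_n for 0 ≤ n ≤ N−1. Let f_r be the reconstruction from (q_n). Then for all t ∈ ℝ, |f(t) − f_r(t)| ≤ ((2π)^{m−1}·max_{0≤n≤N−1}|u_n| / N^m)·(‖(φ^K)^{(m)}‖_{L¹[0,2π]} + ‖(φ^K)^{(m−1)}‖_∞) + (1/N)·Σ_{k=1}^{m−1} (2π/N)^{k−1}·|(Δ^{m−k}u)_{N−1}|·‖(φ^K)^{(k−1)}‖_∞. -/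
noncomputable section
open Real
open scoped Classical

/-- Backward difference of a sequence. -/
def bdiff (u : ℤ → ℝ) : ℤ → ℝ := fun n => u n - u (n - 1)

/-- The Dirichlet kernel `φᴷ`. -/
def dirichlet (K : ℕ) (x : ℝ) : ℝ :=
  if ∃ m : ℤ, x = 2 * π * m then 2 * K + 1
  else Real.sin ((2 * K + 1) * x / 2) / Real.sin (x / 2)

/-- `f : ℝ → ℝ` is `K`-bandlimited on the circle. -/
def KBandlimited (K : ℕ) (f : ℝ → ℝ) : Prop :=
  ∃ c : ℤ → ℂ, ∀ t : ℝ, (f t : ℂ) =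
    ∑ ξ ∈ Finset.Icc (-(K : ℤ)) (K : ℤ), c ξ * Complex.exp (Complex.I * ξ * t)

open scoped ContDiff

/-- The operator `ψ ↦ ψ(·) - ψ(· - h)`. -/
def stepDiff (h : ℝ) (ψ : ℝ → ℝ) : ℝ → ℝ := fun x => ψ x - ψ (x - h)

lemma contDiff_stepDiff (h : ℝ) {ψ : ℝ → ℝ} (hψ : ContDiff ℝ ∞ ψ) :
    ContDiff ℝ ∞ (stepDiff h ψ) := by
  unfold stepDiff
  fun_prop

lemma deriv_stepDiff (h : ℝ) {ψ : ℝ → ℝ} (hψ : ContDiff ℝ ∞ ψ) :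
    deriv (stepDiff h ψ) = stepDiff h (deriv ψ) := by
  have hd : Differentiable ℝ ψ := hψ.differentiable (by simp)
  funext x
  unfold stepDiff
  rw [deriv_fun_sub (by fun_prop) (by fun_prop), deriv_comp_sub_const]

lemma contDiff_iterate_stepDiff (h : ℝ) (j : ℕ) {ψ : ℝ → ℝ} (hψ : ContDiff ℝ ∞ ψ) :
    ContDiff ℝ ∞ ((stepDiff h)^[j] ψ) := by
  induction j with
  | zero => exact hψ
  | succ j ih =>
    rw [Function.iterate_succ_apply']
    exact contDiff_stepDiff h ih

lemma deriv_iterate_stepDiff (h : ℝ) (j : ℕ) {ψ : ℝ → ℝ} (hψ : ContDiff ℝ ∞ ψ) :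
    deriv ((stepDiff h)^[j] ψ) = (stepDiff h)^[j] (deriv ψ) := by
  induction j with
  | zero => rfl
  | succ j ih =>
    rw [Function.iterate_succ_apply', Function.iterate_succ_apply',
      deriv_stepDiff h (contDiff_iterate_stepDiff h j hψ), ih]

lemma abs_iterate_stepDiff_le {h M : ℝ} (hh : 0 ≤ h) (j : ℕ) {ψ : ℝ → ℝ}
    (hψ : ContDiff ℝ ∞ ψ) (hM : ∀ x, |iteratedDeriv j ψ x| ≤ M) (x : ℝ) :
    |(stepDiff h)^[j] ψ x| ≤ h ^ j * M := by
  induction j generalizing ψ x with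
  | zero => simpa using hM x
  | succ j ih =>
    have hψ' : ContDiff ℝ ∞ (deriv ψ) := (contDiff_infty_iff_deriv.mp hψ).2
    have hb := ih hψ' (by simpa [iteratedDeriv_succ'] using hM)
    have hmv := Convex.norm_image_sub_le_of_norm_deriv_le (𝕜 := ℝ) (s := Set.univ)
      (f := (stepDiff h)^[j] ψ) (C := h ^ j * M) (x := x - h) (y := x)
      (fun y _ => (contDiff_iterate_stepDiff h j hψ).differentiable (by simp) y)
      (fun y _ => by rw [deriv_iterate_stepDiff h j hψ]; exact hb y)
      convex_univ (Set.mem_univ _) (Set.mem_univ _)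
    rw [Function.iterate_succ_apply']
    have habs : ‖x - (x - h)‖ = h := by rw [sub_sub_cancel, Real.norm_of_nonneg hh]
    rw [habs] at hmv
    calc |stepDiff h ((stepDiff h)^[j] ψ) x| ≤ h ^ j * M * h := hmv
      _ = h ^ (j + 1) * M := by ring

lemma stepDiff_eq_integral (h : ℝ) {ψ : ℝ → ℝ} (hψ : ContDiff ℝ ∞ ψ) (x : ℝ) :
    stepDiff h ψ x = ∫ s in (0 : ℝ)..h, deriv ψ (x - s) := by
  have hc : Continuous (deriv ψ) := (contDiff_infty_iff_deriv.mp hψ).2.continuous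
  rw [intervalIntegral.integral_comp_sub_left (fun y => deriv ψ y), sub_zero,
    intervalIntegral.integral_deriv_eq_sub (fun y _ => hψ.differentiable (by simp) y)
      (hc.intervalIntegrable _ _)]
  rfl

lemma periodic_deriv {ψ : ℝ → ℝ} {T : ℝ} (hψ : Function.Periodic ψ T) :
    Function.Periodic (deriv ψ) T := by
  intro x
  rw [← deriv_comp_add_const]
  congr 1
  exact funext hψ

lemma periodic_iteratedDeriv {ψ : ℝ → ℝ} {T : ℝ} (hψ : Function.Periodic ψ T) (j : ℕ) :
    Function.Periodic (iteratedDeriv j ψ) T := by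
  induction j with
  | zero => simpa using hψ
  | succ j ih =>
    rw [iteratedDeriv_succ]
    exact periodic_deriv ih

/-- The sum over a period grid of the `(j+1)`-st differences of a periodic function is controlled
by the `L¹` norm of its `(j+1)`-st derivative. -/
lemma sum_abs_iterate_stepDiff_le {T : ℝ} {N : ℕ} (hT : 0 ≤ T) (hN : N ≠ 0) (j : ℕ)
    {ψ : ℝ → ℝ} (hψ : ContDiff ℝ ∞ ψ) (hp : Function.Periodic ψ T) (t : ℝ) :
    ∑ n ∈ Finset.range N, |(stepDiff (T / N))^[j + 1] ψ (t - n * (T / N))| ≤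
      (T / N) ^ j * ∫ x in (0 : ℝ)..T, |iteratedDeriv (j + 1) ψ x| := by
  have hh : 0 ≤ T / N := by positivity
  have hNh : (N : ℝ) * (T / N) = T := by field_simp
  set h := T / N
  induction j generalizing ψ t with
  | zero =>
    have hc : Continuous (deriv ψ) := (contDiff_infty_iff_deriv.mp hψ).2.continuous
    have hpa : Function.Periodic (fun x => |deriv ψ x|) T := fun x => by
      simp only [periodic_deriv hp x]
    have hterm : ∀ n ∈ Finset.range N, |(stepDiff h)^[0 + 1] ψ (t - n * h)| ≤
        -∫ x in (t - (n : ℕ) * h)..(t - ((n + 1 : ℕ) : ℝ) * h), |deriv ψ x| := by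
      intro n _
      rw [zero_add, Function.iterate_one, stepDiff_eq_integral h hψ,
        ← intervalIntegral.integral_symm]
      refine (intervalIntegral.abs_integral_le_integral_abs hh).trans_eq ?_
      rw [intervalIntegral.integral_comp_sub_left (fun y => |deriv ψ y|)]
      congr 1 <;> push_cast <;> ring
    refine (Finset.sum_le_sum hterm).trans_eq ?_
    rw [Finset.sum_neg_distrib,
      intervalIntegral.sum_integral_adjacent_intervals (a := fun n : ℕ => t - (n : ℝ) * h)
        (fun k _ => hc.abs.intervalIntegrable _ _),
      ← intervalIntegral.integral_symm, hNh]
    have := hpa.intervalIntegral_add_eq (t - T) 0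
    simpa [iteratedDeriv_one] using this
  | succ j ih =>
    have hψ' : ContDiff ℝ ∞ (deriv ψ) := (contDiff_infty_iff_deriv.mp hψ).2
    have hcS : Continuous ((stepDiff h)^[j + 1] (deriv ψ)) :=
      (contDiff_iterate_stepDiff h (j + 1) hψ').continuous
    have hterm : ∀ n ∈ Finset.range N, |(stepDiff h)^[j + 1 + 1] ψ (t - n * h)| ≤
        ∫ s in (0 : ℝ)..h, |(stepDiff h)^[j + 1] (deriv ψ) (t - n * h - s)| := by
      intro n _
      rw [Function.iterate_succ_apply',
        stepDiff_eq_integral h (contDiff_iterate_stepDiff h (j + 1) hψ),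
        deriv_iterate_stepDiff h (j + 1) hψ]
      exact intervalIntegral.abs_integral_le_integral_abs hh
    refine (Finset.sum_le_sum hterm).trans ?_
    rw [← intervalIntegral.integral_finsetSum
      (fun n _ => Continuous.intervalIntegrable (by fun_prop) _ _)]
    have hbound : ∀ s : ℝ,
        ∑ n ∈ Finset.range N, |(stepDiff h)^[j + 1] (deriv ψ) (t - n * h - s)| ≤
          h ^ j * ∫ x in (0 : ℝ)..T, |iteratedDeriv (j + 1 + 1) ψ x| := by
      intro s
      have := ih hψ' (periodic_deriv hp) (t - s)
      rw [iteratedDeriv_succ' (n := j + 1)]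
      simpa only [sub_right_comm] using this
    refine (intervalIntegral.integral_mono_on hh
      (Continuous.intervalIntegrable (by fun_prop) _ _)
      intervalIntegrable_const (fun s _ => hbound s)).trans_eq ?_
    rw [intervalIntegral.integral_const, smul_eq_mul]
    ring

lemma iterate_bdiff_eq_zero (m : ℕ) {u : ℤ → ℝ} {a : ℤ}
    (hu : ∀ j : ℕ, j ≤ m → u (a - j) = 0) : (bdiff^[m] u) a = 0 := by
  induction m generalizing a with
  | zero => simpa using hu 0 le_rfl
  | succ m ih =>
    rw [Function.iterate_succ_apply', bdiff, ih fun j hj => hu j (by omega),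
      ih fun j hj => ?_, sub_zero]
    have := hu (j + 1) (by omega)
    rwa [Nat.cast_succ, add_comm, ← sub_sub] at this

lemma sum_bdiff_mul (v : ℤ → ℝ) (hv : v (-1) = 0) (N : ℕ) (h t : ℝ) (φ : ℝ → ℝ) :
    ∑ n ∈ Finset.range N, bdiff v n * φ (t - n * h) =
      v ((N : ℤ) - 1) * φ (t - N * h) +
        ∑ n ∈ Finset.range N, v n * stepDiff h φ (t - n * h) := by
  induction N with
  | zero => simp [hv]
  | succ N ih =>
    have e : t - (N : ℝ) * h - h = t - ((N : ℝ) + 1) * h := by ring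
    rw [Finset.sum_range_succ, Finset.sum_range_succ, ih]
    simp only [bdiff, stepDiff, Nat.cast_succ, add_sub_cancel_right, e]
    ring

lemma sum_iterate_bdiff_mul (m : ℕ) (u : ℤ → ℝ)
    (hu : ∀ j : ℕ, 1 ≤ j → j ≤ m → u (-(j : ℤ)) = 0) (N : ℕ) (h t : ℝ) (φ : ℝ → ℝ) :
    ∑ n ∈ Finset.range N, (bdiff^[m] u) n * φ (t - n * h) =
      ∑ k ∈ Finset.range m,
          (bdiff^[m - 1 - k] u) ((N : ℤ) - 1) * (stepDiff h)^[k] φ (t - N * h) +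
        ∑ n ∈ Finset.range N, u n * (stepDiff h)^[m] φ (t - n * h) := by
  induction m generalizing φ with
  | zero => simp
  | succ m ih =>
    have hv : (bdiff^[m] u) (-1) = 0 := iterate_bdiff_eq_zero m fun j hj => by
      rw [← hu (j + 1) (by omega) (by omega)]
      congr 1
      push_cast
      ring
    rw [Function.iterate_succ_apply', sum_bdiff_mul _ hv,
      ih (fun j h1 hj => hu j h1 (by omega)), Finset.sum_range_succ' _ m]
    simp only [Nat.sub_sub, Nat.add_comm 1, Function.iterate_succ_apply,
      Function.iterate_zero, id_eq, Nat.add_sub_cancel, Nat.sub_zero]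
    ac_rfl

lemma Icc_neg_succ (K : ℕ) :
    Finset.Icc (-((K + 1 : ℕ) : ℤ)) ((K + 1 : ℕ) : ℤ) =
      insert (-((K : ℤ) + 1)) (insert ((K : ℤ) + 1) (Finset.Icc (-(K : ℤ)) (K : ℤ))) := by
  ext x
  simp only [Finset.mem_insert, Finset.mem_Icc]
  push_cast
  omega

lemma sin_half_mul_sum_cos (K : ℕ) (x : ℝ) :
    Real.sin (x / 2) * ∑ ξ ∈ Finset.Icc (-(K : ℤ)) (K : ℤ), Real.cos (ξ * x) =
      Real.sin ((2 * K + 1) * x / 2) := by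
  induction K with
  | zero => simp
  | succ K ih =>
    rw [Icc_neg_succ, Finset.sum_insert (by simp; omega), Finset.sum_insert (by simp), mul_add,
      mul_add, ih]
    push_cast
    have e_add : (2 * ((K : ℝ) + 1) + 1) * x / 2 = ((K : ℝ) + 1) * x + x / 2 := by ring
    have e_sub : (2 * (K : ℝ) + 1) * x / 2 = ((K : ℝ) + 1) * x - x / 2 := by ring
    rw [show -((K : ℝ) + 1) * x = -(((K : ℝ) + 1) * x) by ring, Real.cos_neg, e_add, e_sub,
      Real.sin_add, Real.sin_sub]
    ring

lemma dirichlet_eq_sum_cos (K : ℕ) :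
    dirichlet K = fun x => ∑ ξ ∈ Finset.Icc (-(K : ℤ)) (K : ℤ), Real.cos (ξ * x) := by
  funext x
  unfold dirichlet
  split_ifs with hx
  · obtain ⟨m, rfl⟩ := hx
    have hcos : ∀ ξ : ℤ, Real.cos (ξ * (2 * π * m)) = 1 := fun ξ => by
      rw [show (ξ : ℝ) * (2 * π * m) = ((ξ * m : ℤ) : ℝ) * (2 * π) by push_cast; ring]
      exact Real.cos_int_mul_two_pi _
    simp only [hcos, Finset.sum_const, Int.card_Icc, nsmul_eq_mul, mul_one]
    rw [show ((K : ℤ) + 1 - -(K : ℤ)).toNat = 2 * K + 1 by omega]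
    push_cast
    ring
  · have hs : Real.sin (x / 2) ≠ 0 := fun h0 => by
      obtain ⟨n, hn⟩ := Real.sin_eq_zero_iff.mp h0
      exact hx ⟨n, by linarith⟩
    rw [div_eq_iff hs, ← sin_half_mul_sum_cos, mul_comm]

lemma contDiff_dirichlet (K : ℕ) : ContDiff ℝ ∞ (dirichlet K) := by
  rw [dirichlet_eq_sum_cos]
  fun_prop

lemma periodic_dirichlet (K : ℕ) : Function.Periodic (dirichlet K) (2 * π) := by
  intro x
  simp only [dirichlet_eq_sum_cos]
  refine Finset.sum_congr rfl fun ξ _ => ?_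
  rw [mul_add, Real.cos_add_int_mul_two_pi]

lemma abs_iteratedDeriv_dirichlet_le_iSup (K j : ℕ) (x : ℝ) :
    |iteratedDeriv j (dirichlet K) x| ≤ ⨆ y : ℝ, |iteratedDeriv j (dirichlet K) y| := by
  have hc : Continuous fun y => |iteratedDeriv j (dirichlet K) y| :=
    ((contDiff_dirichlet K).continuous_iteratedDeriv j (by exact_mod_cast le_top)).abs
  have hp : Function.Periodic (fun y => |iteratedDeriv j (dirichlet K) y|) (2 * π) := fun y => by
    simp only [periodic_iteratedDeriv (periodic_dirichlet K) j y]
  exact le_ciSup (hp.isBounded_of_continuous Real.two_pi_pos.ne' hc).bddAbove x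

lemma ofReal_dirichlet (K : ℕ) (x : ℝ) :
    (dirichlet K x : ℂ) =
      ∑ η ∈ Finset.Icc (-(K : ℤ)) (K : ℤ), Complex.exp (Complex.I * η * x) := by
  have hneg : ∑ η ∈ Finset.Icc (-(K : ℤ)) (K : ℤ), Complex.exp (-(Complex.I * η * x)) =
      ∑ η ∈ Finset.Icc (-(K : ℤ)) (K : ℤ), Complex.exp (Complex.I * η * x) :=
    Finset.sum_nbij' (fun η => -η) (fun η => -η) (by simp; omega) (by simp; omega) (by simp)
      (by simp) (fun η _ => by push_cast; ring_nf)
  have hcos : ∀ η : ℤ, ((Real.cos (η * x) : ℝ) : ℂ) =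
      (Complex.exp (Complex.I * η * x) + Complex.exp (-(Complex.I * η * x))) / 2 := fun η => by
    rw [Complex.ofReal_cos, Complex.cos]
    push_cast
    ring_nf
  simp only [dirichlet_eq_sum_cos, Complex.ofReal_sum, hcos]
  rw [← Finset.sum_div, Finset.sum_add_distrib, hneg]
  ring

lemma sum_exp_grid {N : ℕ} (hN : N ≠ 0) {d : ℤ} (hd : |d| < N) :
    ∑ n ∈ Finset.range N, Complex.exp (Complex.I * d * (2 * π * n / N)) =
      if d = 0 then (N : ℂ) else 0 := by
  split_ifs with h0
  · simp [h0]
  · have hNC : (N : ℂ) ≠ 0 := Nat.cast_ne_zero.mpr hN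
    have hpow : ∀ n : ℕ, Complex.exp (Complex.I * d * (2 * π * n / N)) =
        Complex.exp (Complex.I * d * (2 * π / N)) ^ n := fun n => by
      rw [← Complex.exp_nat_mul]
      ring_nf
    have hone : Complex.exp (Complex.I * d * (2 * π / N)) ≠ 1 := fun h1 => by
      obtain ⟨k, hk⟩ := Complex.exp_eq_one_iff.mp h1
      have hk' : (d : ℂ) = k * N := by
        have hpi : (2 * π * Complex.I : ℂ) ≠ 0 := Complex.two_pi_I_ne_zero
        field_simp at hk
        rw [hk, mul_comm]
      have hdk : d = N * k := by
        rw [mul_comm]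
        exact_mod_cast hk'
      exact h0 (Int.eq_zero_of_abs_lt_dvd ⟨k, hdk⟩ hd)
    simp only [hpow]
    rw [geom_sum_eq hone, ← hpow, mul_div_assoc, div_self hNC, mul_one,
      show Complex.I * d * (2 * π) = d * (2 * π * Complex.I) by ring,
      Complex.exp_int_mul_two_pi_mul_I, sub_self, zero_div]

/-- Bandlimited functions are reconstructed exactly from their samples. -/
lemma KBandlimited.eq_sum_dirichlet {K N : ℕ} (hN : 2 * K + 1 ≤ N) {f : ℝ → ℝ}
    (hf : KBandlimited K f) (t : ℝ) :
    f t = (1 / N) * ∑ n ∈ Finset.range N, f (2 * π * n / N) * dirichlet K (t - 2 * π * n / N) := by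
  obtain ⟨c, hc⟩ := hf
  have hN0 : N ≠ 0 := by omega
  have hNC : (N : ℂ) ≠ 0 := Nat.cast_ne_zero.mpr hN0
  apply Complex.ofReal_injective
  push_cast
  simp only [hc, ofReal_dirichlet, Finset.sum_mul_sum]
  rw [Finset.sum_comm, Finset.mul_sum]
  refine Finset.sum_congr rfl fun ξ hξ => ?_
  rw [Finset.sum_comm]
  have hterm : ∀ η ∈ Finset.Icc (-(K : ℤ)) (K : ℤ), ∑ n ∈ Finset.range N,
      c ξ * Complex.exp (Complex.I * ξ * ((2 * π * n / N : ℝ) : ℂ)) *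
        Complex.exp (Complex.I * η * ((t - 2 * π * n / N : ℝ) : ℂ)) =
      if ξ = η then c ξ * Complex.exp (Complex.I * η * t) * N else 0 := by
    intro η hη
    have hfac : ∀ n : ℕ, c ξ * Complex.exp (Complex.I * ξ * ((2 * π * n / N : ℝ) : ℂ)) *
        Complex.exp (Complex.I * η * ((t - 2 * π * n / N : ℝ) : ℂ)) =
        c ξ * Complex.exp (Complex.I * η * t) *
          Complex.exp (Complex.I * ((ξ - η : ℤ) : ℂ) * (2 * π * n / N)) := fun n => by
      rw [mul_assoc, mul_assoc (c ξ), ← Complex.exp_add, ← Complex.exp_add]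
      push_cast
      ring_nf
    simp only [Finset.mem_Icc] at hξ hη
    simp only [hfac]
    rw [← Finset.mul_sum, sum_exp_grid hN0 (by rw [abs_lt]; omega)]
    simp only [sub_eq_zero, mul_ite, mul_zero]
  rw [Finset.sum_congr rfl hterm, Finset.sum_ite_eq, if_pos hξ]
  field_simp

/-- **Error analysis for the `m`-th order ΣΔ scheme on the circle** (m ≥ 2).
If `f` is `K`-bandlimited, `N ≥ 2K+1`, `yₙ = f(2πn/N)`, and `u` satisfies
`u₋₁ = ⋯ = u₋ₘ = 0` and `(Δᵐu)ₙ = yₙ - qₙ` for `0 ≤ n ≤ N-1`, then for all `t`,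
`|f(t) - fᵣ(t)| ≤ ((2π)^{m-1} maxₙ|uₙ| / Nᵐ)(‖(φᴷ)⁽ᵐ⁾‖_{L¹} + ‖(φᴷ)⁽ᵐ⁻¹⁾‖_∞)
  + (1/N) ∑_{k=1}^{m-1} (2π/N)^{k-1} |(Δ^{m-k}u)_{N-1}| ‖(φᴷ)⁽ᵏ⁻¹⁾‖_∞`. -/
theorem mth_order_error (m : ℕ) (hm : 2 ≤ m) (K N : ℕ) (hN : 2 * K + 1 ≤ N)
    (f : ℝ → ℝ) (hf : KBandlimited K f)
    (q u : ℤ → ℝ)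
    (hu0 : ∀ j : ℕ, 1 ≤ j → j ≤ m → u (-(j : ℤ)) = 0)
    (hrec : ∀ n : ℤ, 0 ≤ n → n < (N : ℤ) →
      (bdiff^[m] u) n = f (2 * π * n / N) - q n) :
    ∀ t : ℝ,
      |f t - (1 / N) * ∑ n ∈ Finset.range N, q n * dirichlet K (t - 2 * π * n / N)| ≤
        ((2 * π) ^ (m - 1) * (⨆ n : Fin N, |u ((n : ℕ) : ℤ)|) / (N : ℝ) ^ m) *
            ((∫ x in (0 : ℝ)..(2 * π), |iteratedDeriv m (dirichlet K) x|) +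
              ⨆ x : ℝ, |iteratedDeriv (m - 1) (dirichlet K) x|) +
          (1 / N) * ∑ k ∈ Finset.Icc 1 (m - 1),
            (2 * π / N) ^ (k - 1) * |(bdiff^[m - k] u) ((N : ℤ) - 1)| *
              ⨆ x : ℝ, |iteratedDeriv (k - 1) (dirichlet K) x| := by
  intro t
  have hN0 : N ≠ 0 := by omega
  set h : ℝ := 2 * π / N with hh
  have hh0 : 0 ≤ h := by positivity
  set U : ℝ := ⨆ n : Fin N, |u ((n : ℕ) : ℤ)|
  set M : ℕ → ℝ := fun j => ⨆ x : ℝ, |iteratedDeriv j (dirichlet K) x|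
  set L : ℝ := ∫ x in (0 : ℝ)..(2 * π), |iteratedDeriv m (dirichlet K) x|
  have hu_le : ∀ n < N, |u (n : ℤ)| ≤ U := fun n hn =>
    le_ciSup (f := fun n : Fin N => |u ((n : ℕ) : ℤ)|) (Set.finite_range _).bddAbove ⟨n, hn⟩
  have hstep : ∀ j x, |(stepDiff h)^[j] (dirichlet K) x| ≤ h ^ j * M j := fun j x =>
    abs_iterate_stepDiff_le hh0 j (contDiff_dirichlet K)
      (abs_iteratedDeriv_dirichlet_le_iSup K j) x
  have herr : f t - (1 / N) * ∑ n ∈ Finset.range N, q n * dirichlet K (t - 2 * π * n / N) =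
      (1 / N) * ∑ n ∈ Finset.range N, (bdiff^[m] u) n * dirichlet K (t - n * h) := by
    rw [hf.eq_sum_dirichlet hN t, ← mul_sub, ← Finset.sum_sub_distrib]
    congr 1
    refine Finset.sum_congr rfl fun n hn => ?_
    rw [hrec n (by positivity) (by exact_mod_cast Finset.mem_range.mp hn), ← sub_mul, hh,
      mul_div_assoc', mul_comm (n : ℝ), Int.cast_natCast]
  obtain ⟨p, rfl⟩ : ∃ p, m = p + 1 := ⟨m - 1, by omega⟩
  rw [herr, sum_iterate_bdiff_mul (p + 1) u hu0, Finset.sum_range_succ, abs_mul,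
    abs_of_nonneg (by positivity : (0 : ℝ) ≤ 1 / N)]
  simp only [Nat.add_sub_cancel, Nat.sub_self, Function.iterate_zero, id_eq]
  have hlow : |∑ k ∈ Finset.range p,
      (bdiff^[p - k] u) ((N : ℤ) - 1) * (stepDiff h)^[k] (dirichlet K) (t - N * h)| ≤
      ∑ k ∈ Finset.Icc 1 p, h ^ (k - 1) * |(bdiff^[p + 1 - k] u) ((N : ℤ) - 1)| * M (k - 1) := by
    rw [← Finset.Ico_add_one_right_eq_Icc, Finset.sum_Ico_eq_sum_range]
    refine (Finset.abs_sum_le_sum_abs _ _).trans (Finset.sum_le_sum fun k _ => ?_)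
    rw [abs_mul, show p + 1 - (1 + k) = p - k by omega, Nat.add_sub_cancel_left]
    calc _ ≤ |(bdiff^[p - k] u) ((N : ℤ) - 1)| * (h ^ k * M k) := by gcongr; exact hstep k _
      _ = _ := by ring
  have htop : |u ((N : ℤ) - 1) * (stepDiff h)^[p] (dirichlet K) (t - N * h)| ≤
      U * (h ^ p * M p) := by
    have hlast : |u ((N : ℤ) - 1)| ≤ U := by
      simpa [Nat.cast_sub (Nat.one_le_iff_ne_zero.mpr hN0)] using hu_le (N - 1) (by omega)
    rw [abs_mul]
    exact mul_le_mul hlast (hstep p _) (abs_nonneg _) ((abs_nonneg _).trans hlast)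
  have hU0 : 0 ≤ U := (abs_nonneg _).trans (hu_le 0 (by omega))
  have hint : |∑ n ∈ Finset.range N, u n * (stepDiff h)^[p + 1] (dirichlet K) (t - n * h)| ≤
      U * (h ^ p * L) := by
    refine (Finset.abs_sum_le_sum_abs _ _).trans ?_
    refine le_trans ?_ (mul_le_mul_of_nonneg_left
      (sum_abs_iterate_stepDiff_le Real.two_pi_pos.le hN0 p (contDiff_dirichlet K)
        (periodic_dirichlet K) t) hU0)
    rw [Finset.mul_sum]
    refine Finset.sum_le_sum fun n hn => ?_
    rw [abs_mul]
    exact mul_le_mul_of_nonneg_right (hu_le n (Finset.mem_range.mp hn)) (abs_nonneg _)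
  calc _ ≤ 1 / (N : ℝ) * ((∑ k ∈ Finset.Icc 1 p,
        h ^ (k - 1) * |(bdiff^[p + 1 - k] u) ((N : ℤ) - 1)| * M (k - 1)) +
        U * (h ^ p * M p) + U * (h ^ p * L)) := by
        gcongr
        exact (abs_add_le _ _).trans
          (add_le_add ((abs_add_le _ _).trans (add_le_add hlow htop)) hint)
    _ = _ := by
        have hscale : (2 * π) ^ p * U / (N : ℝ) ^ (p + 1) = 1 / N * (U * h ^ p) := by
          rw [hh, div_pow, pow_succ]
          field_simp
        rw [hscale]
        ring
end
end

section
/- (Sampling formula on the circle) Let f be K-bandlimited on the circle and let N ≥ 2K+1. Then for all t ∈ ℝ, f(t) = (1/N) Σ_{n=0}^{N−1} f(2πn/N) · φ^K(t − 2πn/N). -/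
noncomputable section
open Real
open scoped Classical

theorem dirichlet_zero (x : ℝ) : dirichlet 0 x = 1 := by
  unfold dirichlet
  split_ifs with h
  · simp
  · have hs : Real.sin (x / 2) ≠ 0 := by
      intro h0
      obtain ⟨m, hm⟩ := Real.sin_eq_zero_iff.mp h0
      exact h ⟨m, by linarith⟩
    simp [hs]

theorem dirichlet_succ (K : ℕ) (x : ℝ) :
    dirichlet (K + 1) x = dirichlet K x + 2 * Real.cos ((K + 1) * x) := by
  unfold dirichlet
  split_ifs with h
  · obtain ⟨m, rfl⟩ := h
    have hc : Real.cos ((K + 1) * (2 * π * m)) = 1 :=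
      (Real.cos_eq_one_iff _).mpr ⟨(K + 1) * m, by push_cast; ring⟩
    rw [hc]
    push_cast
    ring
  · have hs : Real.sin (x / 2) ≠ 0 := by
      intro h0
      obtain ⟨m, hm⟩ := Real.sin_eq_zero_iff.mp h0
      exact h ⟨m, by linarith⟩
    have h1 : (2 * ((K + 1 : ℕ) : ℝ) + 1) * x / 2 = (K + 1) * x + x / 2 := by
      push_cast
      ring
    have h2 : (2 * (K : ℝ) + 1) * x / 2 = (K + 1) * x - x / 2 := by ring
    rw [h1, h2, Real.sin_add, Real.sin_sub]
    field_simp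
    ring

/-- The Dirichlet kernel is the sum of the characters of frequency at most `K`. -/
theorem dirichlet_eq_sum_exp (K : ℕ) (x : ℝ) :
    (dirichlet K x : ℂ) =
      ∑ ξ ∈ Finset.Icc (-(K : ℤ)) (K : ℤ), Complex.exp (Complex.I * ξ * x) := by
  induction K with
  | zero => simp [dirichlet_zero]
  | succ K ih =>
    have hI : Finset.Icc (-((K + 1 : ℕ) : ℤ)) ((K + 1 : ℕ) : ℤ) =
        insert (-((K : ℤ) + 1)) (insert ((K : ℤ) + 1) (Finset.Icc (-(K : ℤ)) (K : ℤ))) := by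
      ext a
      simp only [Finset.mem_Icc, Finset.mem_insert]
      omega
    rw [hI, Finset.sum_insert (by simp only [Finset.mem_Icc, Finset.mem_insert]; omega),
      Finset.sum_insert (by simp only [Finset.mem_Icc]; omega), ← ih, dirichlet_succ]
    push_cast
    rw [Complex.two_cos]
    ring_nf

/-- Orthogonality of characters on the `N`-th roots of unity. -/
theorem sum_exp_sample_eq_zero (N : ℕ) (j : ℤ) (hj : ¬ (N : ℤ) ∣ j) :
    ∑ n ∈ Finset.range N, Complex.exp (Complex.I * j * (2 * π * n / N)) = 0 := by
  rcases eq_or_ne N 0 with rfl | hN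
  · simp
  have hζ := Complex.isPrimitiveRoot_exp N hN
  set ζ := Complex.exp (2 * π * Complex.I / N) with hζ_def
  have hterm : ∀ n ∈ Finset.range N,
      Complex.exp (Complex.I * j * (2 * π * n / N)) = (ζ ^ j) ^ n := by
    intro n _
    rw [hζ_def, ← Complex.exp_int_mul, ← Complex.exp_nat_mul]
    ring_nf
  have hne : ζ ^ j ≠ 1 := fun h => hj ((hζ.zpow_eq_one_iff_dvd j).mp h)
  have hpow : (ζ ^ j) ^ N = 1 := by
    rw [← zpow_natCast, ← zpow_mul, mul_comm, zpow_mul, zpow_natCast, hζ.pow_eq_one, one_zpow]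
  rw [Finset.sum_congr rfl hterm, geom_sum_eq hne, hpow, sub_self, zero_div]

/-- **Sampling formula on the circle.**
If `f` is `K`-bandlimited and `N ≥ 2K+1`, then for all `t`,
`f(t) = (1/N) ∑_{n=0}^{N-1} f(2πn/N) φᴷ(t - 2πn/N)`. -/
theorem sampling_formula (K N : ℕ) (hN : 2 * K + 1 ≤ N)
    (f : ℝ → ℝ) (hf : KBandlimited K f) :
    ∀ t : ℝ, f t =
      (1 / N) * ∑ n ∈ Finset.range N, f (2 * π * n / N) * dirichlet K (t - 2 * π * n / N) := by
  intro t
  obtain ⟨c, hc⟩ := hf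
  have hN0 : (N : ℂ) ≠ 0 := by
    have : N ≠ 0 := by omega
    exact_mod_cast this
  have key : ∑ n ∈ Finset.range N,
      (f (2 * π * n / N) : ℂ) * (dirichlet K (t - 2 * π * n / N) : ℂ) = N * (f t : ℂ) := by
    calc
      _ = ∑ n ∈ Finset.range N, ∑ ξ ∈ Finset.Icc (-(K : ℤ)) (K : ℤ),
          ∑ η ∈ Finset.Icc (-(K : ℤ)) (K : ℤ), c ξ * Complex.exp (Complex.I * η * t) *
            Complex.exp (Complex.I * ((ξ - η : ℤ) : ℂ) * (2 * π * n / N)) := by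
        refine Finset.sum_congr rfl fun n _ => ?_
        rw [hc, dirichlet_eq_sum_exp, Finset.sum_mul_sum]
        refine Finset.sum_congr rfl fun ξ _ => Finset.sum_congr rfl fun η _ => ?_
        rw [mul_assoc (c ξ), mul_assoc (c ξ), ← Complex.exp_add, ← Complex.exp_add]
        push_cast
        ring_nf
      _ = ∑ ξ ∈ Finset.Icc (-(K : ℤ)) (K : ℤ), ∑ η ∈ Finset.Icc (-(K : ℤ)) (K : ℤ),
          c ξ * Complex.exp (Complex.I * η * t) * ∑ n ∈ Finset.range N,
            Complex.exp (Complex.I * ((ξ - η : ℤ) : ℂ) * (2 * π * n / N)) := by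
        rw [Finset.sum_comm]
        refine Finset.sum_congr rfl fun ξ _ => ?_
        rw [Finset.sum_comm]
        simp only [Finset.mul_sum]
      _ = ∑ ξ ∈ Finset.Icc (-(K : ℤ)) (K : ℤ), c ξ * Complex.exp (Complex.I * ξ * t) * N := by
        refine Finset.sum_congr rfl fun ξ hξ => ?_
        rw [Finset.sum_eq_single_of_mem ξ hξ]
        · simp
        · intro η hη hne
          rw [sum_exp_sample_eq_zero, mul_zero]
          intro hdvd
          rw [Finset.mem_Icc] at hξ hη
          have h0 := Int.eq_zero_of_abs_lt_dvd hdvd (by rw [abs_lt]; omega)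
          omega
      _ = N * (f t : ℂ) := by rw [← Finset.sum_mul, ← hc, mul_comm]
  have hC : (f t : ℂ) = ((1 / N) * ∑ n ∈ Finset.range N,
      f (2 * π * n / N) * dirichlet K (t - 2 * π * n / N) : ℝ) := by
    rw [Complex.ofReal_mul, Complex.ofReal_sum]
    simp only [Complex.ofReal_mul (f _)]
    rw [key]
    push_cast
    field_simp
  exact_mod_cast hC
end
end
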